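/- The 14 × 14 Hermitian matrix G(I_14) has rank 8 and, counted with multiplicity, exactly 7 of its (necessarily real) eigenvalues are positive, exactly 1 is negative, and exactly 6 are zero. (The Hermitian form on the Gauss lattice L(I_14, 𝒢) has a six-dimensional kernel whose quotient is the rank 8 Lorentzian Gauss lattice L(Y_322, 𝒢).) -/

import Mathlib

open scoped Classical

namespace AllcockStmt19

noncomputable section

/-- The points of the projective plane `ℙ²(𝔽₂)`: the 7 one-dimensional linear
subspaces of `𝔽₂³`. -/
abbrev Pt := {W : Submodule (ZMod 2) (Fin 3 → ZMod 2) // Module.finrank (ZMod 2) W = 1}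

/-- The lines of the projective plane `ℙ²(𝔽₂)`: the 7 two-dimensional linear
subspaces of `𝔽₂³`. -/
abbrev Ln := {W : Submodule (ZMod 2) (Fin 3 → ZMod 2) // Module.finrank (ZMod 2) W = 2}

instance : DecidableEq Pt := Classical.decEq _
instance : DecidableEq Ln := Classical.decEq _

/-- The Gram matrix `G(I_14)` of the incidence diagram of `ℙ²(𝔽₂)`, indexed by
the `14` nodes `P ⊔ L`: diagonal entries `2`, entry `1 + i` in position
`(p, l)` and `1 - i` in position `(l, p)` for every incident pair (`p ⊆ l`),
all other entries `0`. -/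
def G : Matrix (Pt ⊕ Ln) (Pt ⊕ Ln) ℂ := fun u v =>
  match u, v with
  | Sum.inl p, Sum.inl q => if p = q then 2 else 0
  | Sum.inl p, Sum.inr l => if p.1 ≤ l.1 then 1 + Complex.I else 0
  | Sum.inr l, Sum.inl p => if p.1 ≤ l.1 then 1 - Complex.I else 0
  | Sum.inr l, Sum.inr m => if l = m then 2 else 0

/-- The nonzero vectors of `𝔽₂³`, which parametrize both the points and the lines. -/
abbrev NonzeroVec := {v : Fin 3 → ZMod 2 // v ≠ 0}

lemma span_singleton_injective_zmod_two {v w : Fin 3 → ZMod 2} (hv : v ≠ 0)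
    (h : Submodule.span (ZMod 2) {v} = Submodule.span (ZMod 2) {w}) : v = w := by
  have hmem : v ∈ Submodule.span (ZMod 2) {w} := h ▸ Submodule.mem_span_singleton_self v
  obtain ⟨c, rfl⟩ := Submodule.mem_span_singleton.1 hmem
  have hc : ∀ c : ZMod 2, c = 0 ∨ c = 1 := by decide
  rcases hc c with rfl | rfl
  · simp at hv
  · simp

lemma exists_span_pt (p : Pt) : ∃ v : NonzeroVec, Submodule.span (ZMod 2) {v.1} = p.1 := by
  obtain ⟨W, hW⟩ := p
  have hne : W ≠ ⊥ := by
    rintro rfl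
    simp at hW
  obtain ⟨v, hv, hv0⟩ := W.exists_mem_ne_zero_of_ne_bot hne
  refine ⟨⟨v, hv0⟩, Submodule.eq_of_le_of_finrank_eq ?_ ?_⟩
  · simpa using hv
  · rw [finrank_span_singleton hv0, hW]

/-- A nonzero vector spans a point. -/
def ptEquiv : NonzeroVec ≃ Pt :=
  Equiv.ofBijective (fun v => ⟨Submodule.span (ZMod 2) {v.1}, finrank_span_singleton v.2⟩)
    ⟨fun v _ h => Subtype.ext (span_singleton_injective_zmod_two v.2 (congrArg Subtype.val h)),
      fun p => (exists_span_pt p).imp fun _ hv => Subtype.ext hv⟩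

/-- The hyperplane orthogonal to `w` for the dot product. -/
def orthLine (w : Fin 3 → ZMod 2) : Submodule (ZMod 2) (Fin 3 → ZMod 2) :=
  LinearMap.ker (dotProductEquiv (ZMod 2) (Fin 3) w)

lemma mem_orthLine {v w : Fin 3 → ZMod 2} : v ∈ orthLine w ↔ w ⬝ᵥ v = 0 := Iff.rfl

lemma finrank_orthLine {w : Fin 3 → ZMod 2} (hw : w ≠ 0) :
    Module.finrank (ZMod 2) (orthLine w) = 2 := by
  have h := Module.Dual.finrank_ker_add_one_of_ne_zero
    (f := dotProductEquiv (ZMod 2) (Fin 3) w) (by simpa using hw)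
  rw [Module.finrank_fin_fun] at h
  exact Nat.succ_injective h

lemma orthLine_injective {v w : Fin 3 → ZMod 2} (h : orthLine v = orthLine w) : v = w := by
  have key : ∀ v w : Fin 3 → ZMod 2, (∀ u : Fin 3 → ZMod 2, v ⬝ᵥ u = 0 ↔ w ⬝ᵥ u = 0) → v = w := by
    decide
  exact key v w fun u => by rw [← mem_orthLine, ← mem_orthLine, h]

lemma exists_orthLine_ln (l : Ln) : ∃ w : NonzeroVec, orthLine w.1 = l.1 := by
  obtain ⟨W, hW⟩ := l
  have hlt : W < ⊤ := by
    refine lt_top_iff_ne_top.2 ?_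
    rintro rfl
    simp at hW
  obtain ⟨f, hf, hle⟩ := W.exists_le_ker_of_lt_top hlt
  obtain ⟨w, rfl⟩ := (dotProductEquiv (ZMod 2) (Fin 3)).surjective f
  have hw : w ≠ 0 := by
    rintro rfl
    simp at hf
  refine ⟨⟨w, hw⟩, (Submodule.eq_of_le_of_finrank_eq hle ?_).symm⟩
  rw [hW]
  exact (finrank_orthLine hw).symm

/-- A nonzero vector determines the line orthogonal to it. -/
def lnEquiv : NonzeroVec ≃ Ln :=
  Equiv.ofBijective (fun w => ⟨orthLine w.1, finrank_orthLine w.2⟩)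
    ⟨fun _ _ h => Subtype.ext (orthLine_injective (congrArg Subtype.val h)),
      fun l => (exists_orthLine_ln l).imp fun _ hw => Subtype.ext hw⟩

lemma ptEquiv_le_lnEquiv (v w : NonzeroVec) :
    (ptEquiv v).1 ≤ (lnEquiv w).1 ↔ w.1 ⬝ᵥ v.1 = 0 := by
  change Submodule.span (ZMod 2) {v.1} ≤ orthLine w.1 ↔ _
  rw [Submodule.span_singleton_le_iff_mem, mem_orthLine]

lemma card_nonzeroVec [Fintype NonzeroVec] : Fintype.card NonzeroVec = 7 := by
  rw [← Nat.card_eq_fintype_card, Nat.subtype_card (Finset.univ.filter (· ≠ 0)) (by simp)]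
  decide +kernel

lemma card_pt : Fintype.card Pt = 7 := by
  rw [← Fintype.card_congr ptEquiv, card_nonzeroVec]

lemma card_ln : Fintype.card Ln = 7 := by
  rw [← Fintype.card_congr lnEquiv, card_nonzeroVec]

lemma card_common_orthogonal (u v : NonzeroVec) :
    Nat.card {w : NonzeroVec // w.1 ⬝ᵥ u.1 = 0 ∧ w.1 ⬝ᵥ v.1 = 0} = if u = v then 3 else 1 := by
  have key : ∀ u v : Fin 3 → ZMod 2, u ≠ 0 → v ≠ 0 →
      (Finset.univ.filter fun w : Fin 3 → ZMod 2 =>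
        w ≠ 0 ∧ w ⬝ᵥ u = 0 ∧ w ⬝ᵥ v = 0).card = if u = v then 3 else 1 := by
    decide +kernel
  have e := Equiv.subtypeSubtypeEquivSubtypeInter (fun w : Fin 3 → ZMod 2 => w ≠ 0)
    (fun w => w ⬝ᵥ u.1 = 0 ∧ w ⬝ᵥ v.1 = 0)
  rw [Nat.card_congr e, Nat.subtype_card (Finset.univ.filter fun w : Fin 3 → ZMod 2 =>
    w ≠ 0 ∧ w ⬝ᵥ u.1 = 0 ∧ w ⬝ᵥ v.1 = 0) (by simp), key u.1 v.1 u.2 v.2]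
  simp only [Subtype.ext_iff]

lemma card_lines_through (p q : Pt) :
    (Finset.univ.filter fun l : Ln => p.1 ≤ l.1 ∧ q.1 ≤ l.1).card = if p = q then 3 else 1 := by
  obtain ⟨u, rfl⟩ := ptEquiv.surjective p
  obtain ⟨v, rfl⟩ := ptEquiv.surjective q
  rw [← Fintype.card_subtype, ← Nat.card_eq_fintype_card,
    ← Nat.card_congr (lnEquiv.subtypeEquiv fun w => by rw [ptEquiv_le_lnEquiv, ptEquiv_le_lnEquiv]),
    card_common_orthogonal]
  simp

lemma card_points_on (l m : Ln) :
    (Finset.univ.filter fun p : Pt => p.1 ≤ l.1 ∧ p.1 ≤ m.1).card = if l = m then 3 else 1 := by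
  obtain ⟨u, rfl⟩ := lnEquiv.surjective l
  obtain ⟨v, rfl⟩ := lnEquiv.surjective m
  rw [← Fintype.card_subtype, ← Nat.card_eq_fintype_card,
    ← Nat.card_congr (ptEquiv.subtypeEquiv fun w => by
      rw [ptEquiv_le_lnEquiv, ptEquiv_le_lnEquiv, dotProduct_comm u.1, dotProduct_comm v.1]),
    card_common_orthogonal]
  simp

open Matrix Polynomial

/-- The incidence matrix of `ℙ²(𝔽₂)`. -/
def incidence : Matrix Pt Ln ℂ := Matrix.of fun p l => if p.1 ≤ l.1 then 1 else 0

/-- The square all-ones matrix. -/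
abbrev allOnes (n : Type*) : Matrix n n ℂ := Matrix.of fun _ _ => 1

lemma allOnes_mul_self (n : Type*) [Fintype n] :
    allOnes n * allOnes n = (Fintype.card n : ℂ) • allOnes n := by
  ext
  simp [Matrix.mul_apply]

lemma incidence_mul_transpose : incidence * incidenceᵀ = (2 : ℂ) • 1 + allOnes Pt := by
  ext p q
  have h := congrArg (Nat.cast (R := ℂ)) (card_lines_through p q)
  simp only [Matrix.mul_apply, incidence, Matrix.transpose_apply, Matrix.of_apply, ← ite_and,
    mul_ite, mul_one, mul_zero, Matrix.add_apply, Matrix.smul_apply, Matrix.one_apply, smul_eq_mul]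
  rw [Finset.card_filter] at h
  push_cast at h
  simp only [and_comm] at h ⊢
  rw [h]
  split_ifs <;> norm_num

lemma transpose_mul_incidence : incidenceᵀ * incidence = (2 : ℂ) • 1 + allOnes Ln := by
  ext l m
  have h := congrArg (Nat.cast (R := ℂ)) (card_points_on l m)
  simp only [Matrix.mul_apply, incidence, Matrix.transpose_apply, Matrix.of_apply, ← ite_and,
    mul_ite, mul_one, mul_zero, Matrix.add_apply, Matrix.smul_apply, Matrix.one_apply, smul_eq_mul]
  rw [Finset.card_filter] at h
  push_cast at h
  simp only [and_comm] at h ⊢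
  rw [h]
  split_ifs <;> norm_num

lemma G_isHermitian : G.IsHermitian := by
  ext u v
  rcases u with p | l <;> rcases v with q | m <;>
    simp [G, Matrix.conjTranspose_apply, apply_ite (starRingEnd ℂ), eq_comm, sub_eq_add_neg,
      Complex.conj_ofNat]

lemma G_sub_two : G - (2 : ℂ) • 1 =
    Matrix.fromBlocks 0 ((1 + Complex.I) • incidence) ((1 - Complex.I) • incidenceᵀ) 0 := by
  ext u v
  rcases u with p | l <;> rcases v with q | m <;>
    simp [G, incidence, Matrix.one_apply]

lemma G_sub_two_sq : (G - (2 : ℂ) • 1) ^ 2 =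
    (4 : ℂ) • 1 + (2 : ℂ) • Matrix.fromBlocks (allOnes Pt) 0 0 (allOnes Ln) := by
  have h₁ : (1 + Complex.I) * (1 - Complex.I) = 2 := by ring_nf; simp; norm_num
  have h₂ : (1 - Complex.I) * (1 + Complex.I) = 2 := by rw [mul_comm, h₁]
  rw [G_sub_two, sq, Matrix.fromBlocks_multiply, ← Matrix.fromBlocks_one, Matrix.fromBlocks_smul,
    Matrix.fromBlocks_smul, Matrix.fromBlocks_add]
  simp only [Matrix.smul_mul, Matrix.mul_smul, smul_smul, h₁, h₂, incidence_mul_transpose,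
    transpose_mul_incidence, smul_add]
  norm_num [← mul_assoc, h₁, h₂]

lemma blockOnes_sq :
    Matrix.fromBlocks (allOnes Pt) 0 0 (allOnes Ln) * Matrix.fromBlocks (allOnes Pt) 0 0 (allOnes Ln)
      = (7 : ℂ) • Matrix.fromBlocks (allOnes Pt) 0 0 (allOnes Ln) := by
  rw [Matrix.fromBlocks_multiply, Matrix.fromBlocks_smul]
  simp [allOnes_mul_self, card_pt, card_ln]

lemma G_annihilated : ((G - (2 : ℂ) • 1) ^ 2 - (4 : ℂ) • 1) * ((G - (2 : ℂ) • 1) ^ 2 - (18 : ℂ) • 1)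
    = 0 := by
  rw [G_sub_two_sq, add_sub_cancel_left, Matrix.mul_sub, Matrix.mul_add]
  simp only [Matrix.smul_mul, Matrix.mul_smul, blockOnes_sq, Matrix.mul_one, smul_smul]
  module

lemma trace_G_sub_two : (G - (2 : ℂ) • 1).trace = 0 := by
  rw [G_sub_two]
  simp [Matrix.trace]

lemma trace_G_sub_two_sq : ((G - (2 : ℂ) • 1) ^ 2).trace = 84 := by
  rw [G_sub_two_sq, Matrix.trace_add, Matrix.trace_smul, Matrix.trace_smul, Matrix.trace_one]
  simp [Matrix.trace, card_pt, card_ln]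
  norm_num

section Spectral

variable {n : Type*} [Fintype n] [DecidableEq n] {A : Matrix n n ℂ}

lemma aeval_eq_conj_diagonal (hA : A.IsHermitian) (p : ℂ[X]) :
    aeval A p = Unitary.conjStarAlgAut ℂ _ hA.eigenvectorUnitary
      (diagonal fun i => p.eval (hA.eigenvalues i : ℂ)) := by
  have h : aeval (diagonal (RCLike.ofReal ∘ hA.eigenvalues) : Matrix n n ℂ) p =
      diagonal fun i => p.eval (hA.eigenvalues i : ℂ) := by
    rw [← Matrix.diagonalAlgHom_apply (R := ℂ), aeval_algHom_apply, Matrix.diagonalAlgHom_apply]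
    congr 1
    ext i
    simp [aeval_def, eval₂_eq_eval_map]
  conv_lhs => rw [hA.spectral_theorem]
  rw [← h, aeval_algHom_apply]

lemma eval_eigenvalues_eq_zero (hA : A.IsHermitian) {p : ℂ[X]} (hp : aeval A p = 0) (i : n) :
    p.eval (hA.eigenvalues i : ℂ) = 0 := by
  rw [aeval_eq_conj_diagonal hA, map_eq_zero_iff _ (EquivLike.injective _)] at hp
  simpa using congrFun (congrFun hp i) i

lemma trace_aeval (hA : A.IsHermitian) (p : ℂ[X]) :
    (aeval A p).trace = ∑ i, p.eval (hA.eigenvalues i : ℂ) := by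
  rw [aeval_eq_conj_diagonal hA, Unitary.conjStarAlgAut_apply, Matrix.trace_mul_cycle]
  simp [Matrix.trace_diagonal]

end Spectral

lemma G_eigenvalues_cases (hH : G.IsHermitian) (i : Pt ⊕ Ln) :
    hH.eigenvalues i = 0 ∨ hH.eigenvalues i = 4 ∨
      hH.eigenvalues i = 2 + 3 * √2 ∨ hH.eigenvalues i = 2 - 3 * √2 := by
  have h := eval_eigenvalues_eq_zero hH
    (p := ((X - C 2) ^ 2 - C 4) * ((X - C 2) ^ 2 - C 18))
    (by simpa [Algebra.algebraMap_eq_smul_one] using G_annihilated) i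
  simp only [eval_mul, eval_sub, eval_pow, eval_X, eval_C] at h
  set x := hH.eigenvalues i
  have hx : ((x - 2) ^ 2 - 4) * ((x - 2) ^ 2 - 18) = 0 := by exact_mod_cast h
  have hs : √2 ^ 2 = (2 : ℝ) := Real.sq_sqrt (by norm_num)
  have hx' : x * ((x - 4) * ((x - (2 + 3 * √2)) * (x - (2 - 3 * √2)))) = 0 := by
    linear_combination hx - 9 * x * (x - 4) * hs
  simpa [sub_eq_zero] using hx'

lemma sum_G_eigenvalues_sub_two (hH : G.IsHermitian) : ∑ i, (hH.eigenvalues i - 2) = 0 := by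
  have h := trace_aeval hH (X - C 2)
  have h' : aeval G (X - C 2 : ℂ[X]) = G - (2 : ℂ) • 1 := by
    simp [Algebra.algebraMap_eq_smul_one]
  rw [h', trace_G_sub_two] at h
  simp only [eval_sub, eval_X, eval_C] at h
  exact_mod_cast h.symm

lemma sum_G_eigenvalues_sub_two_sq (hH : G.IsHermitian) :
    ∑ i, (hH.eigenvalues i - 2) ^ 2 = 84 := by
  have h := trace_aeval hH ((X - C 2) ^ 2)
  have h' : aeval G ((X - C 2) ^ 2 : ℂ[X]) = (G - (2 : ℂ) • 1) ^ 2 := by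
    simp [Algebra.algebraMap_eq_smul_one]
  rw [h', trace_G_sub_two_sq] at h
  simp only [eval_sub, eval_X, eval_C, eval_pow] at h
  exact_mod_cast h.symm

/-- A weighted count of the indices of a family taking four distinct values. -/
lemma sum_eq_of_four_values {ι : Type*} [Fintype ι] (x : ι → ℝ) {a b c d : ℝ}
    (hx : ∀ i, x i = a ∨ x i = b ∨ x i = c ∨ x i = d) (hab : a ≠ b) (hac : a ≠ c) (had : a ≠ d)
    (hbc : b ≠ c) (hbd : b ≠ d) (hcd : c ≠ d) (f : ℝ → ℝ) :
    ∑ i, f (x i) = (Finset.univ.filter fun i => x i = a).card * f a +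
      (Finset.univ.filter fun i => x i = b).card * f b +
      (Finset.univ.filter fun i => x i = c).card * f c +
      (Finset.univ.filter fun i => x i = d).card * f d := by
  simp only [Finset.card_filter, Nat.cast_sum, Finset.sum_mul, ← Finset.sum_add_distrib]
  refine Finset.sum_congr rfl fun i _ => ?_
  rcases hx i with h | h | h | h <;>
    simp [h, hab, hac, had, hbc, hbd, hcd, hab.symm, hac.symm, had.symm, hbc.symm, hbd.symm,
      hcd.symm]

lemma multiplicities_eq {a b c d : ℕ} (h₀ : (a + b + c + d : ℝ) = 14)
    (h₁ : (a * (-2) + b * 2 + c * (3 * √2) + d * (-(3 * √2)) : ℝ) = 0)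
    (h₂ : (a * 4 + b * 4 + c * 18 + d * 18 : ℝ) = 84) : a = 6 ∧ b = 6 ∧ c = 1 ∧ d = 1 := by
  have hs : √2 ^ 2 = (2 : ℝ) := Real.sq_sqrt (by norm_num)
  have hsq : (4 * ((b : ℝ) - a) ^ 2) = 18 * ((d : ℝ) - c) ^ 2 := by
    have : 2 * ((b : ℝ) - a) = 3 * √2 * (d - c) := by linear_combination h₁
    linear_combination (2 * ((b : ℝ) - a) + 3 * √2 * (d - c)) * this + 9 * (d - c) ^ 2 * hs
  have hsq' : 4 * ((b : ℤ) - a) ^ 2 = 18 * ((d : ℤ) - c) ^ 2 := by exact_mod_cast hsq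
  have h₀' : a + b + c + d = 14 := by exact_mod_cast h₀
  have h₂' : a * 4 + b * 4 + c * 18 + d * 18 = 84 := by exact_mod_cast h₂
  have hcd : d = 2 - c := by omega
  have hab : b = 12 - a := by omega
  have hc : c ≤ 2 := by omega
  have ha : a ≤ 12 := by omega
  subst hcd hab
  clear h₀ h₁ h₂ hsq
  interval_cases c <;> interval_cases a <;> simp_all

/-- The `14 × 14` Hermitian matrix `G(I_14)` has rank `8` and,
counted with multiplicity, exactly `7` of its (necessarily real) eigenvalues
are positive, exactly `1` is negative, and exactly `6` are zero. -/
theorem G_I14_rank_and_signature :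
    ∃ hH : G.IsHermitian,
      G.rank = 8 ∧
      (Finset.univ.filter fun i => 0 < hH.eigenvalues i).card = 7 ∧
      (Finset.univ.filter fun i => hH.eigenvalues i < 0).card = 1 ∧
      (Finset.univ.filter fun i => hH.eigenvalues i = 0).card = 6 := by
  have hs : 1.4 < √2 := Real.lt_sqrt_of_sq_lt (by norm_num)
  have hs2 : √2 ^ 2 = (2 : ℝ) := Real.sq_sqrt (by norm_num)
  refine ⟨G_isHermitian, ?_⟩
  have hsum := sum_eq_of_four_values G_isHermitian.eigenvalues (G_eigenvalues_cases G_isHermitian)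
    (by norm_num) (by linarith) (by linarith) (by linarith) (by linarith) (by linarith)
  have hsum₁ := sum_G_eigenvalues_sub_two G_isHermitian
  have hsum₂ := sum_G_eigenvalues_sub_two_sq G_isHermitian
  have hrank := G_isHermitian.rank_eq_card_non_zero_eigs
  rw [Fintype.card_subtype] at hrank
  generalize G_isHermitian.eigenvalues = x at *
  have h₀ := hsum fun _ => 1
  have h₁ := hsum fun t => t - 2
  have h₂ := hsum fun t => (t - 2) ^ 2
  have hcount (P : ℝ → Prop) : ((Finset.univ.filter fun i => P (x i)).card : ℝ) = _ :=
    (by simp : _ = ∑ i, if P (x i) then (1 : ℝ) else 0).trans (hsum fun t => if P t then 1 else 0)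
  rw [hsum₁] at h₁
  rw [hsum₂] at h₂
  rw [Finset.sum_const, Finset.card_univ, Fintype.card_sum, card_pt, card_ln] at h₀
  clear hsum
  generalize ha : (Finset.univ.filter fun i => x i = 0).card = a at *
  generalize hb : (Finset.univ.filter fun i => x i = 4).card = b at *
  generalize hc : (Finset.univ.filter fun i => x i = 2 + 3 * √2).card = c at *
  generalize hd : (Finset.univ.filter fun i => x i = 2 - 3 * √2).card = d at *
  norm_num at h₀
  obtain ⟨rfl, rfl, rfl, rfl⟩ := multiplicities_eq (a := a) (b := b) (c := c) (d := d)
    (by linear_combination -h₀) (by linear_combination -h₁)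
    (by linear_combination -h₂ - 9 * (c + d : ℝ) * hs2)
  have hp : 0 < 2 + 3 * √2 := by linarith
  have hn : 2 - 3 * √2 < 0 := by linarith
  refine ⟨?_, ?_, ?_, rfl⟩
  · have h := hcount (· ≠ 0)
    norm_num [hp.ne', hn.ne] at h
    rw [hrank]
    exact_mod_cast h
  · have h := hcount (0 < ·)
    simp only [hp, hn.not_gt, if_true, if_false] at h
    norm_num at h
    exact_mod_cast h
  · have h := hcount (· < 0)
    simp only [hp.not_gt, hn, if_true, if_false] at h
    norm_num at h
    exact_mod_cast h

end

end AllcockStmt19
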